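/- Let Γ be the Coxeter symbol (†). Then the assignment s ↦ (𝟎, s) for nodes s of Ψ and t_i ↦ (𝐮_i, 1) for 1 ≤ i ≤ m extends to a surjective group homomorphism φ : W(Γ) → ∏_{i=1}^m Λ_i/2 ⋊ W(Ψ); moreover, if every pair (Ψ, s_i) is admissible, the target is a finite group of order 2^{mn}·|W(Ψ)|. -/

import Mathlib

namespace RootPaper

/-- The type of an irreducible Weyl symbol (Killing-Cartan type). -/
inductive WeylType : Type
  | A : ℕ → WeylType
  | B : ℕ → WeylType
  | D : ℕ → WeylType
  | G2 : WeylType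
  | F4 : WeylType
  | E6 : WeylType
  | E7 : WeylType
  | E8 : WeylType

namespace WeylType

/-- The rank (number of nodes of the symbol). -/
def rank : WeylType → ℕ
  | A n => n
  | B n => n
  | D n => n
  | G2 => 2
  | F4 => 4
  | E6 => 6
  | E7 => 7
  | E8 => 8

/-- The rank restrictions making the types distinct irreducible Weyl symbols. -/
def Valid : WeylType → Prop
  | A n => 1 ≤ n
  | B n => 2 ≤ n
  | D n => 4 ≤ n
  | _ => True

/-- Coxeter matrix entry for sorted (0-based) indices `i ≤ j`.  Node `s_k` of the paper
(1-based) corresponds to the index `k - 1`. -/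
def cmRaw : WeylType → ℕ → ℕ → ℕ
  | A _, i, j => if i = j then 1 else if i + 1 = j then 3 else 2
  | B n, i, j => if i = j then 1 else if i + 1 = j then (if j = n - 1 then 4 else 3) else 2
  | D n, i, j => if i = j then 1 else
      if (i + 1 = j ∧ j ≤ n - 2) ∨ (i = n - 3 ∧ j = n - 1) then 3 else 2
  | G2, i, j => if i = j then 1 else 6
  | F4, i, j => if i = j then 1 else if i + 1 = j then (if i = 1 then 4 else 3) else 2
  | E6, i, j => if i = j then 1 else if (i + 1 = j ∧ j ≤ 4) ∨ (i = 2 ∧ j = 5) then 3 else 2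
  | E7, i, j => if i = j then 1 else if (i + 1 = j ∧ j ≤ 5) ∨ (i = 2 ∧ j = 6) then 3 else 2
  | E8, i, j => if i = j then 1 else if (i + 1 = j ∧ j ≤ 6) ∨ (i = 2 ∧ j = 7) then 3 else 2

/-- The Coxeter matrix entry `m_{s t}` of the symbol, for 0-based indices. -/
def cm (t : WeylType) (i j : ℕ) : ℕ := cmRaw t (min i j) (max i j)

theorem cm_symm (t : WeylType) (i j : ℕ) : cm t i j = cm t j i := by
  unfold cm; rw [min_comm, max_comm]

theorem cm_diag (t : WeylType) (i : ℕ) : cm t i i = 1 := by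
  cases t <;> simp [cm, cmRaw]

theorem cmRaw_ne_one (t : WeylType) (i j : ℕ) (h : i ≠ j) : cmRaw t i j ≠ 1 := by
  cases t <;> simp only [cmRaw, if_neg h] <;> first | omega | (split_ifs <;> omega)

theorem cm_ne_one (t : WeylType) (i j : ℕ) (h : i ≠ j) : cm t i j ≠ 1 := by
  have : min i j ≠ max i j := by omega
  exact cmRaw_ne_one t _ _ this

end WeylType

open WeylType

/-- The Coxeter matrix of the irreducible Weyl symbol `t`. -/
def weylCM (t : WeylType) : CoxeterMatrix (Fin t.rank) where
  M := Matrix.of fun i j => cm t i.val j.val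
  isSymm := by
    unfold Matrix.IsSymm
    ext i j
    simpa [Matrix.of_apply] using cm_symm t j.val i.val
  diagonal := fun i => cm_diag t i.val
  off_diagonal := fun i j h => cm_ne_one t i.val j.val (by simpa [Fin.val_inj] using h)

/-- The visible (parabolic) subgroup of a Coxeter group generated by a subset of the nodes. -/
def visible {B W : Type*} [Group W] {M : CoxeterMatrix B} (cs : CoxeterSystem M W)
    (T : Set B) : Subgroup W :=
  Subgroup.closure (cs.simple '' T)




open WeylType

/-- Cartan-type integers for the paper's root-lattice basis `x_1, ..., x_n`:
`cartan t i j = 2 (x_i, x_j) / (x_i, x_i)` (0-based indices). -/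
def cartan (t : WeylType) (i j : ℕ) : ℤ :=
  if i = j then 2
  else if cm t i j = 2 then 0
  else
    match t with
    | .B n => if i + 1 = j ∧ j = n - 1 then -2 else -1
    | .G2 => if i = 0 then -3 else -1
    | .F4 => if i = 1 ∧ j = 2 then -2 else -1
    | _ => -1

/-- Twice the Gram matrix of the root-lattice basis: `gram t i j = 2 (x_i, x_j)`,
normalised so that the simple roots `v_i` are unit vectors. -/
def gram (t : WeylType) (i j : ℕ) : ℤ :=
  if i = j then
    (match t with
     | .B n => if i = n - 1 then 4 else 2
     | .G2 => if i = 1 then 6 else 2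
     | .F4 => if 2 ≤ i then 4 else 2
     | _ => 2)
  else if cm t i j = 2 then 0
  else
    (match t with
     | .B n => if max i j = n - 1 then -2 else -1
     | .G2 => -3
     | .F4 => if 2 ≤ max i j then -2 else -1
     | _ => -1)

/-- Twice the invariant inner product of two root-lattice vectors, written in
coordinates with respect to the basis `x_1, ..., x_n`. -/
def inner2 (t : WeylType) (u v : Fin t.rank → ℤ) : ℤ :=
  ∑ i, ∑ j, u i * gram t i.val j.val * v j

/-- The matrix of the simple reflection `s_i` acting on the root lattice in the basis
`x_1, ..., x_n`: `s_i (x_j) = x_j - cartan t i j • x_i`. -/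
def reflM (t : WeylType) (i : Fin t.rank) : Matrix (Fin t.rank) (Fin t.rank) ℤ :=
  Matrix.of fun k j => (if k = j then 1 else 0) - (if k = i then cartan t i.val j.val else 0)

/-- The reduction of `reflM` modulo `2`, i.e. the action of `s_i` on `L/2L`. -/
def reflM2 (t : WeylType) (i : Fin t.rank) : Matrix (Fin t.rank) (Fin t.rank) (ZMod 2) :=
  (reflM t i).map (Int.cast)

/-- The matrix of the Coxeter element `s_1 s_2 ⋯ s_n` acting on the root lattice. -/
def coxM (t : WeylType) : Matrix (Fin t.rank) (Fin t.rank) ℤ :=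
  ((List.finRange t.rank).map (reflM t)).prod

/-- `u` is (in coordinates w.r.t. `x_1, ..., x_n`) the paper's explicit vector `u_s`:
a nonzero primitive lattice vector orthogonal to `x_t` for all `t ≠ s`, on the positive
side of the wall determined by `x_s`. -/
def IsPaperVector (t : WeylType) (s : Fin t.rank) (u : Fin t.rank → ℤ) : Prop :=
  u ≠ 0 ∧ (Finset.univ.gcd fun i => (u i).natAbs) = 1 ∧
    (∀ j : Fin t.rank, j ≠ s → inner2 t u (Pi.single j 1) = 0) ∧
    0 < inner2 t u (Pi.single s 1)

/-- `x_s = v_s`, i.e. the basis vector at the node `s` (0-based) is an unrescaled simple root. -/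
def Unscaled : WeylType → ℕ → Prop
  | .B n, s => s ≠ n - 1
  | .F4, s => s ≠ 2 ∧ s ≠ 3
  | .G2, s => s ≠ 1
  | _, _ => True

/-- The list of vectors `ū, s_{q_1}(ū), s_{q_2} s_{q_1}(ū), ...` in `L/2L` obtained by
successively applying the reflections along a path `q_1, q_2, ...` in the symbol. -/
def pathVecs (t : WeylType) (w : Fin t.rank → ZMod 2) (p : List (Fin t.rank)) :
    List (Fin t.rank → ZMod 2) :=
  p.scanl (fun v i => (reflM2 t i).mulVec v) w

/-- `p` is an injective path in the symbol of `t` all of whose edges are unlabelled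
(label 3); equivalently, (in a tree) the minimal path between its endpoints spans a
subsymbol of type `A`. -/
def IsA3Path (t : WeylType) (p : List (Fin t.rank)) : Prop :=
  p.Nodup ∧ p.Chain' (fun i j => cm t i.val j.val = 3)

/-- The pair `(Ψ, s)` is specially admissible: `x_s = v_s` and for every node `t'` such that
the minimal path from `s` to `t'` spans a type `A_k` subsymbol, the `k + 1` vectors of
`X^s_{t'}` are linearly independent over `𝔽_2`. -/
def SpeciallyAdmissible (t : WeylType) (s : Fin t.rank) : Prop :=
  Unscaled t s.val ∧
    ∀ u : Fin t.rank → ℤ, IsPaperVector t s u →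
      ∀ p : List (Fin t.rank), p.head? = some s → IsA3Path t p →
        LinearIndependent (ZMod 2)
          (fun q : Fin (pathVecs t (fun i => ((u i : ZMod 2))) p).length =>
            (pathVecs t (fun i => ((u i : ZMod 2))) p).get q)

/-- The pair `(Ψ, s)` is admissible: as in `SpeciallyAdmissible`, but the independence is
required only along type `A_k` paths with `k` odd. -/
def Admissible (t : WeylType) (s : Fin t.rank) : Prop :=
  Unscaled t s.val ∧
    ∀ u : Fin t.rank → ℤ, IsPaperVector t s u →
      ∀ p : List (Fin t.rank), p.head? = some s → IsA3Path t p → Odd p.length →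
        LinearIndependent (ZMod 2)
          (fun q : Fin (pathVecs t (fun i => ((u i : ZMod 2))) p).length =>
            (pathVecs t (fun i => ((u i : ZMod 2))) p).get q)

/-- The exponents `m_1, ..., m_n` of the irreducible Weyl group of type `t`. -/
def exponents : WeylType → List ℕ
  | .A n => (List.range n).map (· + 1)
  | .B n => (List.range n).map (fun k => 2 * k + 1)
  | .D n => ((List.range (n - 1)).map (fun k => 2 * k + 1)) ++ [n - 1]
  | .G2 => [1, 5]
  | .F4 => [1, 5, 7, 11]
  | .E6 => [1, 4, 5, 7, 8, 11]
  | .E7 => [1, 5, 7, 9, 11, 13, 17]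
  | .E8 => [1, 7, 11, 13, 17, 19, 23, 29]

/-- `∏ (m_i + 1)`, which is the order of the Weyl group of type `t`. -/
def orderProd (t : WeylType) : ℕ := ((exponents t).map (· + 1)).prod

/-- The dimension `d_Ψ` of Theorem `section:lattices:result400` of the paper. -/
def dPsi : WeylType → ℕ
  | .A _ => 1
  | .B n => n
  | .D n => if Even n then n else n - 2
  | .G2 => 2
  | .F4 => 4
  | .E6 => 2
  | .E7 => 7
  | .E8 => 8

/-- `ξ` is a Coxeter element: a product of all the simple reflections, each exactly once. -/
def IsCoxeterElt {B W : Type*} [Group W] {M : CoxeterMatrix B} (cs : CoxeterSystem M W)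
    (ξ : W) : Prop :=
  ∃ l : List B, l.Nodup ∧ (∀ i, i ∈ l) ∧ ξ = (l.map cs.simple).prod

/-- The matrix of Coxeter entries of the symbol `(†)`: the Weyl symbol `Ψ` of type `t`
together with `m` new nodes `t_1, ..., t_m`, where `t_k` is joined to the node `s_{a k}`
of `Ψ` by an edge labelled `4` and to no other node. -/
def daggerM (t : WeylType) {m : ℕ} (a : Fin m → Fin t.rank) :
    Matrix (Fin t.rank ⊕ Fin m) (Fin t.rank ⊕ Fin m) ℕ :=
  Matrix.of fun x y =>
    match x, y with
    | Sum.inl i, Sum.inl j => cm t i.val j.val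
    | Sum.inl i, Sum.inr k => if a k = i then 4 else 2
    | Sum.inr k, Sum.inl i => if a k = i then 4 else 2
    | Sum.inr k, Sum.inr l => if k = l then 1 else 2

/-- The Coxeter matrix of the symbol `(†)`. -/
def daggerCM (t : WeylType) {m : ℕ} (a : Fin m → Fin t.rank) :
    CoxeterMatrix (Fin t.rank ⊕ Fin m) where
  M := daggerM t a
  isSymm := by
    unfold Matrix.IsSymm
    ext x y
    rcases x with i | k <;> rcases y with j | l <;>
      simp only [Matrix.transpose_apply, daggerM, Matrix.of_apply] <;>
      first
        | rfl
        | exact cm_symm t _ _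
        | simp [eq_comm]
  diagonal := by
    rintro (i | k) <;> simp [daggerM, cm_diag]
  off_diagonal := by
    rintro (i | k) (j | l) h <;> simp only [daggerM, Matrix.of_apply]
    · exact cm_ne_one t i.val j.val (by simpa [Fin.val_inj] using fun hh => h (by rw [hh]))
    · split_ifs <;> omega
    · split_ifs <;> omega
    · have : k ≠ l := fun hh => h (by rw [hh])
      simp [this]

section Dagger

variable (t : WeylType) {m : ℕ}

/-- The image `ū_k` of the vector `u_k` in `L/2L`. -/
def ubar (u : Fin m → Fin t.rank → ℤ) (k : Fin m) : Fin t.rank → ZMod 2 :=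
  fun i => ((u k i : ZMod 2))

variable {WΨ : Type*} [Group WΨ]

/-- `Λ_k / 2`: the `𝔽_2`-span of the `W(Ψ)`-orbit of `ū_k` in `L/2L`. -/
def Lambda (ρ2 : WΨ →* Module.End (ZMod 2) (Fin t.rank → ZMod 2))
    (u : Fin m → Fin t.rank → ℤ) (k : Fin m) : Submodule (ZMod 2) (Fin t.rank → ZMod 2) :=
  Submodule.span (ZMod 2) {w | ∃ g : WΨ, w = ρ2 g (ubar t u k)}

/-- Membership in `∏_k Λ_k / 2`. -/
def InD (ρ2 : WΨ →* Module.End (ZMod 2) (Fin t.rank → ZMod 2))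
    (u : Fin m → Fin t.rank → ℤ) (v : Fin m → Fin t.rank → ZMod 2) : Prop :=
  ∀ k, v k ∈ Lambda t ρ2 u k

/-- The tuple `𝐮_k ∈ ∏ Λ_j / 2` with `k`-th coordinate `ū_k` and all others `0`. -/
def uTup (u : Fin m → Fin t.rank → ℤ) (k : Fin m) : Fin m → Fin t.rank → ZMod 2 :=
  Pi.single k (ubar t u k)

/-- `(G, π, ι)` realises the semidirect product `∏ Λ_k/2 ⋊ W(Ψ)` induced by the diagonal
action of `W(Ψ)`, with every element written uniquely as `ι 𝐯 * π g`. -/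
structure SdpHyp (ρ2 : WΨ →* Module.End (ZMod 2) (Fin t.rank → ZMod 2))
    (u : Fin m → Fin t.rank → ℤ) {G : Type*} [Group G]
    (π : WΨ →* G) (ι : (Fin m → Fin t.rank → ZMod 2) → G) : Prop where
  map_zero : ι 0 = 1
  map_add : ∀ v w, InD t ρ2 u v → InD t ρ2 u w → ι (v + w) = ι v * ι w
  inj : ∀ v w, InD t ρ2 u v → InD t ρ2 u w → ι v = ι w → v = w
  pi_inj : Function.Injective π
  conj : ∀ (g : WΨ) v, InD t ρ2 u v → π g * ι v * (π g)⁻¹ = ι fun k => ρ2 g (v k)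
  decomp : ∀ x : G, ∃ v g, InD t ρ2 u v ∧ x = ι v * π g
  uniq : ∀ v w g h, InD t ρ2 u v → InD t ρ2 u w → ι v * π g = ι w * π h → v = w ∧ g = h

variable {WΓ : Type*} [Group WΓ]

/-- `φ : W(Γ) → ∏ Λ_k/2 ⋊ W(Ψ)` is the paper's homomorphism: it is determined by
`φ(s) = (𝟎, s)` for nodes `s` of `Ψ` and `φ(t_k) = (𝐮_k, 1)`. -/
def PhiCond {a : Fin m → Fin t.rank} (csΓ : CoxeterSystem (daggerCM t a) WΓ)
    (csΨ : CoxeterSystem (weylCM t) WΨ) {G : Type*} [Group G] (π : WΨ →* G)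
    (ι : (Fin m → Fin t.rank → ZMod 2) → G) (u : Fin m → Fin t.rank → ℤ)
    (φ : WΓ →* G) : Prop :=
  (∀ j : Fin t.rank, φ (csΓ.simple (Sum.inl j)) = π (csΨ.simple j)) ∧
    (∀ k : Fin m, φ (csΓ.simple (Sum.inr k)) = ι (uTup t u k))

/-- The all-ones vector: the value of `ε = (f_1, ..., f_ℓ)` on any Coxeter generator other
than the `t_i`. -/
def onesVec (l : ℕ) : Fin l → ZMod 2 := fun _ => 1

/-- The value of `ε = (f_1, ..., f_ℓ)` on the Coxeter generator `t_k`. -/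
def epsVec (l : ℕ) {m : ℕ} (k : Fin m) : Fin l → ZMod 2 :=
  fun i => if (i : ℕ) = (k : ℕ) then 0 else 1

/-- `φ̂ = ε × φ : W(Γ) → (ℤ/2)^ℓ × (∏ Λ_k/2 ⋊ W(Ψ))` is the paper's homomorphism,
determined by its values on the Coxeter generators. -/
def PhiHatCond {a : Fin m → Fin t.rank} (csΓ : CoxeterSystem (daggerCM t a) WΓ)
    (csΨ : CoxeterSystem (weylCM t) WΨ) {G : Type*} [Group G] (π : WΨ →* G)
    (ι : (Fin m → Fin t.rank → ZMod 2) → G) (u : Fin m → Fin t.rank → ℤ) (l : ℕ)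
    (φh : WΓ →* Multiplicative (Fin l → ZMod 2) × G) : Prop :=
  (∀ j : Fin t.rank, φh (csΓ.simple (Sum.inl j)) =
      (Multiplicative.ofAdd (onesVec l), π (csΨ.simple j))) ∧
    (∀ k : Fin m, φh (csΓ.simple (Sum.inr k)) =
      (Multiplicative.ofAdd (epsVec l k), ι (uTup t u k)))

/-- `w` is the longest element of the visible subgroup `W(Δ)` on the set of nodes `T`. -/
def IsLongest {B : Type*} {M : CoxeterMatrix B} (cs : CoxeterSystem M WΓ) (T : Set B)
    (w : WΓ) : Prop :=
  w ∈ visible cs T ∧ ∀ w' ∈ visible cs T, cs.length w' ≤ cs.length w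

/-- `w` is the element of `W(Δ)`, `Δ ⊆ Ψ` the subsymbol on the nodes `T`, acting as the
antipodal map on the span of the roots of `Δ`; its existence says exactly that `Δ` is a
subsymbol of `(-1)`-type and `w = w_Δ` is its element of longest length. -/
def IsMinusOneElt (csΨ : CoxeterSystem (weylCM t) WΨ)
    (ρ : WΨ →* Module.End ℤ (Fin t.rank → ℤ)) (T : Finset (Fin t.rank)) (w : WΨ) : Prop :=
  w ∈ visible csΨ (T : Set (Fin t.rank)) ∧
    ∀ i ∈ T, ρ w (Pi.single i 1) = -Pi.single i 1

/-- `z` is an involution. -/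
def Invol {G : Type*} [Group G] (z : G) : Prop := z ≠ 1 ∧ z * z = 1

/-- Two nodes of the symbol `(†)` are joined by an edge. -/
def Adjacent (a : Fin m → Fin t.rank) (x y : Fin t.rank ⊕ Fin m) : Prop :=
  x ≠ y ∧ daggerM t a x y ≠ 2

/-- The subsymbol of `(†)` on the set of nodes `T` is connected. -/
def ConnectedSym (a : Fin m → Fin t.rank) (T : Finset (Fin t.rank ⊕ Fin m)) : Prop :=
  T.Nonempty ∧ ∀ x ∈ T, ∀ y ∈ T,
    Relation.ReflTransGen (fun z w => z ∈ T ∧ w ∈ T ∧ Adjacent t a z w) x y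

/-- The subsymbol of `(†)` on the set of nodes `T` is of type `B_k` (where `B_1 = A_1`). -/
def IsTypeB (a : Fin m → Fin t.rank) (T : Finset (Fin t.rank ⊕ Fin m)) (k : ℕ) : Prop :=
  ∃ e : Fin k ≃ {x // x ∈ T}, ∀ i j : Fin k,
    daggerM t a (e i).val (e j).val = cm (WeylType.B k) i.val j.val

end Dagger


theorem cartan_gram (t : WeylType) (i j : Fin t.rank) :
    gram t i.val i.val * cartan t i.val j.val = 2 * gram t i.val j.val := by
  obtain ⟨i, hi⟩ := i
  obtain ⟨j, hj⟩ := j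
  by_cases hij : i = j
  · subst hij
    simp [cartan, mul_comm]
  by_cases h2 : cm t i j = 2
  · simp [cartan, gram, hij, h2]
  cases t with
  | B n =>
    simp only [rank] at hi hj
    simp only [cm, cmRaw] at h2
    simp only [cartan, gram, cm, cmRaw, if_neg hij, if_neg h2]
    split_ifs at h2 ⊢ <;> omega
  | G2 =>
    clear hij h2
    simp only [rank] at hi hj
    interval_cases i <;> interval_cases j <;> decide +revert
  | F4 =>
    clear hij h2
    simp only [rank] at hi hj
    interval_cases i <;> interval_cases j <;> decide +revert
  | _ => simp [cartan, gram, hij, h2]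

theorem gram_self_ne_zero (t : WeylType) (i : ℕ) : gram t i i ≠ 0 := by
  cases t <;> simp only [gram, if_true] <;> first | decide | (split_ifs <;> decide)

theorem gram_comm (t : WeylType) (i j : ℕ) : gram t i j = gram t j i := by
  by_cases hij : i = j
  · rw [hij]
  · simp [gram, hij, Ne.symm hij, cm_symm t j i, max_comm j i]

theorem sum_cartan_eq_zero {t : WeylType} {u : Fin t.rank → ℤ} {j : Fin t.rank}
    (h : inner2 t u (Pi.single j 1) = 0) :
    ∑ i : Fin t.rank, cartan t j.val i.val * u i = 0 := by
  have h' : ∑ i : Fin t.rank, u i * gram t i.val j.val = 0 := by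
    simpa [inner2, Pi.single_apply] using h
  refine (mul_eq_zero.1 ?_).resolve_left (gram_self_ne_zero t j.val)
  calc gram t j.val j.val * ∑ i : Fin t.rank, cartan t j.val i.val * u i
      = 2 * ∑ i : Fin t.rank, u i * gram t i.val j.val := by
        rw [Finset.mul_sum, Finset.mul_sum]
        refine Finset.sum_congr rfl fun i _ => ?_
        rw [← mul_assoc, cartan_gram, gram_comm t i.val j.val]
        ring
    _ = 0 := by rw [h', mul_zero]

theorem reflM2_mulVec (t : WeylType) (i : Fin t.rank) (v : Fin t.rank → ZMod 2) :
    (reflM2 t i).mulVec v =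
      v - (∑ j : Fin t.rank, (cartan t i.val j.val : ZMod 2) * v j) • Pi.single i 1 := by
  ext k
  by_cases hk : k = i
  · subst hk
    simp [reflM2, reflM, Matrix.mulVec, dotProduct, sub_mul, Finset.sum_sub_distrib]
  · simp [reflM2, reflM, Matrix.mulVec, dotProduct, hk]

theorem reflM2_mulVec_ubar {t : WeylType} {m : ℕ} {u : Fin m → Fin t.rank → ℤ} {k : Fin m}
    {j : Fin t.rank} (h : inner2 t (u k) (Pi.single j 1) = 0) :
    (reflM2 t j).mulVec (ubar t u k) = ubar t u k := by
  have h0 : ∑ i : Fin t.rank, (cartan t j.val i.val : ZMod 2) * ubar t u k i = 0 := by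
    have := congrArg (Int.cast : ℤ → ZMod 2) (sum_cartan_eq_zero h)
    simpa [ubar] using this
  rw [reflM2_mulVec, h0, zero_smul, sub_zero]

theorem forall_lt_of_adjacent_steps {P : ℕ → Prop} {N c : ℕ} (hc : c < N) (hPc : P c)
    (hup : ∀ i, i + 1 < N → P i → P (i + 1))
    (hdown : ∀ i, i + 1 < N → i < c → P (i + 1) → P i) : ∀ j, j < N → P j := by
  intro j hj
  rcases le_total c j with h | h
  · induction j, h using Nat.le_induction with
    | base => exact hPc
    | succ i hi ih => exact hup i hj (ih (by omega))
  · induction h using Nat.decreasingInduction with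
    | self => exact hPc
    | of_succ i hi ih => exact hdown i (by omega) hi (ih (by omega))

/-- A path `0, …, N - 1` with one further node `N` attached at `b` is connected. -/
theorem forall_le_of_branched_path {P : ℕ → Prop} {N b c : ℕ} (hb : b < N) (hc : c ≤ N)
    (hPc : P c) (hpath : ∀ i, i + 1 < N → (P i ↔ P (i + 1))) (hbranch : P b ↔ P N) :
    ∀ j, j ≤ N → P j := by
  have key : ∀ d, d < N → P d → ∀ j, j < N → P j := fun d hd hPd =>
    forall_lt_of_adjacent_steps hd hPd (fun i hi => (hpath i hi).1)
      fun i hi _ => (hpath i hi).2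
  have hall : ∀ j, j < N → P j := by
    rcases hc.lt_or_eq with h | rfl
    · exact key c h hPc
    · exact key b hb (hbranch.2 hPc)
  intro j hj
  rcases hj.lt_or_eq with h | rfl
  · exact hall j h
  · exact hbranch.1 (hall b hb)

/-- Following odd Cartan integers from an unscaled node reaches every node of the symbol. -/
theorem forall_of_odd_cartan (t : WeylType) (hval : t.Valid) {s : ℕ} (hs : s < t.rank)
    (hus : Unscaled t s) (P : ℕ → Prop) (h0 : P s)
    (step : ∀ i j, i < t.rank → j < t.rank → Odd (cartan t j i) → P i → P j) :
    ∀ j, j < t.rank → P j := by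
  cases t with
  | A n =>
    simp only [rank] at *
    refine forall_lt_of_adjacent_steps hs h0 (fun i hi => step _ _ (by omega) hi ?_)
      (fun i hi _ => step _ _ hi (by omega) ?_) <;> simp [cartan, cm, cmRaw]
  | B n =>
    simp only [rank, Unscaled] at *
    refine forall_lt_of_adjacent_steps hs h0 (fun i hi => step _ _ (by omega) hi ?_)
      (fun i hi hic => step _ _ hi (by omega) ?_)
    · have h3 : ¬ (i + 1 + 1 = i) := by omega
      have h4 : (if i + 1 = n - 1 then 4 else 3) ≠ 2 := by split_ifs <;> decide
      simp [cartan, cm, cmRaw, h3, h4]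
    · have h3 : ¬ (i + 1 = n - 1) := by omega
      simp [cartan, cm, cmRaw, h3]
  | D n =>
    simp only [rank, Valid] at *
    have hpath : ∀ i, i + 1 < n - 1 → (P i ↔ P (i + 1)) := by
      intro i hi
      have h3 : i + 1 ≤ n - 2 := by omega
      refine ⟨step _ _ (by omega) (by omega) ?_, step _ _ (by omega) (by omega) ?_⟩ <;>
        simp [cartan, cm, cmRaw, h3]
    have hbranch : P (n - 3) ↔ P (n - 1) := by
      have h3 : n - 1 ≠ n - 3 := by omega
      have h4 : n - 3 ≤ n - 1 := by omega
      refine ⟨step _ _ (by omega) (by omega) ?_, step _ _ (by omega) (by omega) ?_⟩ <;>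
        simp [cartan, cm, cmRaw, h3, h3.symm, h4]
    intro j hj
    exact forall_le_of_branched_path (by omega) (by omega) h0 hpath hbranch j (by omega)
  | G2 =>
    simp only [rank, Unscaled] at *
    have e01 := step 0 1 (by decide) (by decide) (by decide)
    intro j hj
    interval_cases s <;> interval_cases j <;> tauto
  | F4 =>
    simp only [rank, Unscaled] at *
    have e01 := step 0 1 (by decide) (by decide) (by decide)
    have e10 := step 1 0 (by decide) (by decide) (by decide)
    have e12 := step 1 2 (by decide) (by decide) (by decide)
    have e23 := step 2 3 (by decide) (by decide) (by decide)
    intro j hj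
    interval_cases s <;> interval_cases j <;> tauto
  | E6 =>
    simp only [rank] at *
    refine fun j hj => forall_le_of_branched_path (N := 5) (b := 2) (by decide)
      (Nat.le_of_lt_succ hs) h0 (fun i hi => ?_)
      ⟨step _ _ (by decide) (by decide) (by decide), step _ _ (by decide) (by decide) (by decide)⟩
      j (Nat.le_of_lt_succ hj)
    have h3 : i + 1 ≤ 4 := by omega
    refine ⟨step _ _ (by omega) (by omega) ?_, step _ _ (by omega) (by omega) ?_⟩ <;>
      simp [cartan, cm, cmRaw, h3]
  | E7 =>
    simp only [rank] at *
    refine fun j hj => forall_le_of_branched_path (N := 6) (b := 2) (by decide)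
      (Nat.le_of_lt_succ hs) h0 (fun i hi => ?_)
      ⟨step _ _ (by decide) (by decide) (by decide), step _ _ (by decide) (by decide) (by decide)⟩
      j (Nat.le_of_lt_succ hj)
    have h3 : i + 1 ≤ 5 := by omega
    refine ⟨step _ _ (by omega) (by omega) ?_, step _ _ (by omega) (by omega) ?_⟩ <;>
      simp [cartan, cm, cmRaw, h3]
  | E8 =>
    simp only [rank] at *
    refine fun j hj => forall_le_of_branched_path (N := 7) (b := 2) (by decide)
      (Nat.le_of_lt_succ hs) h0 (fun i hi => ?_)
      ⟨step _ _ (by decide) (by decide) (by decide), step _ _ (by decide) (by decide) (by decide)⟩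
      j (Nat.le_of_lt_succ hj)
    have h3 : i + 1 ≤ 6 := by omega
    refine ⟨step _ _ (by omega) (by omega) ?_, step _ _ (by omega) (by omega) ?_⟩ <;>
      simp [cartan, cm, cmRaw, h3]

section Dagger

variable {t : WeylType} {m : ℕ} {WΨ : Type*} [Group WΨ]
  {ρ2 : WΨ →* Module.End (ZMod 2) (Fin t.rank → ZMod 2)} {u : Fin m → Fin t.rank → ℤ}

theorem map_mem_Lambda {k : Fin m} {v : Fin t.rank → ZMod 2} (g : WΨ)
    (hv : v ∈ Lambda t ρ2 u k) : ρ2 g v ∈ Lambda t ρ2 u k := by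
  induction hv using Submodule.span_induction with
  | mem x hx =>
    obtain ⟨h, rfl⟩ := hx
    exact Submodule.subset_span ⟨g * h, by rw [map_mul]; rfl⟩
  | zero => rw [map_zero]; exact Submodule.zero_mem _
  | add x y _ _ hx hy => rw [map_add]; exact Submodule.add_mem _ hx hy
  | smul c x _ hx => rw [map_smul]; exact Submodule.smul_mem _ _ hx

theorem ubar_mem_Lambda (k : Fin m) : ubar t u k ∈ Lambda t ρ2 u k :=
  Submodule.subset_span ⟨1, by rw [map_one]; rfl⟩

theorem inD_single {k : Fin m} {v : Fin t.rank → ZMod 2} (hv : v ∈ Lambda t ρ2 u k) :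
    InD t ρ2 u (Pi.single k v) := by
  intro l
  by_cases h : l = k
  · subst h; simpa using hv
  · simp [h]

theorem inD_add {v w : Fin m → Fin t.rank → ZMod 2} (hv : InD t ρ2 u v)
    (hw : InD t ρ2 u w) : InD t ρ2 u (v + w) :=
  fun k => Submodule.add_mem _ (hv k) (hw k)

theorem inD_uTup (k : Fin m) : InD t ρ2 u (uTup t u k) :=
  inD_single (ubar_mem_Lambda k)

theorem apply_single (g : WΨ) (k : Fin m) (v : Fin t.rank → ZMod 2) :
    (fun l => ρ2 g ((Pi.single k v : Fin m → Fin t.rank → ZMod 2) l)) =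
      Pi.single k (ρ2 g v) := by
  ext1 l
  by_cases h : l = k
  · subst h; simp
  · simp [h]

theorem Lambda_eq_top (hval : t.Valid) {csΨ : CoxeterSystem (weylCM t) WΨ}
    (hρ2 : ∀ i, ρ2 (csΨ.simple i) = (reflM2 t i).mulVecLin) {s : Fin t.rank} {k : Fin m}
    (hu : IsPaperVector t s (u k)) (hadm : Admissible t s) : Lambda t ρ2 u k = ⊤ := by
  have hrefl : ∀ i v, v ∈ Lambda t ρ2 u k →
      v - (∑ j : Fin t.rank, (cartan t i.val j.val : ZMod 2) * v j) • Pi.single i 1 ∈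
        Lambda t ρ2 u k := by
    intro i v hv
    rw [← reflM2_mulVec, ← Matrix.mulVecLin_apply, ← hρ2]
    exact map_mem_Lambda _ hv
  have hsingle : ∀ i v, v ∈ Lambda t ρ2 u k →
      ∑ j : Fin t.rank, (cartan t i.val j.val : ZMod 2) * v j ≠ 0 →
        Pi.single i 1 ∈ Lambda t ρ2 u k := by
    intro i v hv hc
    have h := Submodule.sub_mem _ hv (hrefl i v hv)
    rw [sub_sub_cancel] at h
    exact (Submodule.smul_mem_iff _ hc).1 h
  have hs : Pi.single s 1 ∈ Lambda t ρ2 u k := by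
    refine hsingle s (ubar t u k) (ubar_mem_Lambda k) fun hc => ?_
    have hli := hadm.2 (u k) hu [s] rfl ⟨by simp, List.isChain_singleton s⟩ (by simp)
    have hinj := hli.injective.ne
      (a₁ := ⟨0, by simp [pathVecs]⟩) (a₂ := ⟨1, by simp [pathVecs]⟩) (by simp)
    refine hinj ?_
    change ubar t u k = (reflM2 t s).mulVec (ubar t u k)
    rw [reflM2_mulVec, hc, zero_smul, sub_zero]
  have hall := forall_of_odd_cartan t hval s.isLt hadm.1
    (fun n => ∀ h : n < t.rank, Pi.single ⟨n, h⟩ 1 ∈ Lambda t ρ2 u k) (fun _ => hs) (by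
      intro i j hi hj hodd hP _
      refine hsingle ⟨j, hj⟩ _ (hP hi) ?_
      simp only [Pi.single_apply, mul_ite, mul_one, mul_zero, Finset.sum_ite_eq',
        Finset.mem_univ, if_true]
      rw [ZMod.intCast_eq_one_iff_odd.2 hodd]
      exact one_ne_zero)
  rw [eq_top_iff]
  intro v _
  rw [pi_eq_sum_univ' v]
  exact Submodule.sum_mem _ fun i _ => Submodule.smul_mem _ _ (hall i i.isLt i.isLt)

variable {G : Type*} [Group G] {π : WΨ →* G} {ι : (Fin m → Fin t.rank → ZMod 2) → G}

theorem SdpHyp.mul_self (h : SdpHyp t ρ2 u π ι) {v : Fin m → Fin t.rank → ZMod 2}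
    (hv : InD t ρ2 u v) : ι v * ι v = 1 := by
  rw [← h.map_add v v hv hv, ← h.map_zero]
  congr 1
  ext k i
  exact CharTwo.add_self_eq_zero _

theorem SdpHyp.map_mul_comm (h : SdpHyp t ρ2 u π ι) {v w : Fin m → Fin t.rank → ZMod 2}
    (hv : InD t ρ2 u v) (hw : InD t ρ2 u w) : ι v * ι w = ι w * ι v := by
  rw [← h.map_add v w hv hw, ← h.map_add w v hw hv, add_comm]

/-- The involutions `π g` and `ι 𝐯` satisfy `(π g * ι 𝐯) ^ 4 = 1`. -/
theorem SdpHyp.pow_four (h : SdpHyp t ρ2 u π ι) {g : WΨ} (hg : g * g = 1)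
    {v : Fin m → Fin t.rank → ZMod 2} (hv : InD t ρ2 u v) : (π g * ι v) ^ 4 = 1 := by
  have hgi : (π g)⁻¹ = π g := by
    rw [inv_eq_iff_mul_eq_one, ← map_mul, hg, map_one]
  have hgv : InD t ρ2 u fun k => ρ2 g (v k) := fun k => map_mem_Lambda g (hv k)
  have hsq : (π g * ι v) ^ 2 = ι ((fun k => ρ2 g (v k)) + v) := by
    rw [h.map_add _ _ hgv hv, ← h.conj g v hv, hgi, pow_two]
    simp only [mul_assoc]
  rw [show 4 = 2 * 2 from rfl, pow_mul, hsq, pow_two]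
  exact h.mul_self (inD_add hgv hv)

theorem SdpHyp.commute_of_fixed (h : SdpHyp t ρ2 u π ι) {g : WΨ}
    {v : Fin m → Fin t.rank → ZMod 2} (hv : InD t ρ2 u v)
    (hgv : (fun k => ρ2 g (v k)) = v) : Commute (π g) (ι v) := by
  have := h.conj g v hv
  rw [hgv, mul_inv_eq_iff_eq_mul] at this
  exact this

theorem SdpHyp.mem_of_single_mem (h : SdpHyp t ρ2 u π ι) {H : Subgroup G}
    (hH : ∀ k w, w ∈ Lambda t ρ2 u k → ι (Pi.single k w) ∈ H)
    {v : Fin m → Fin t.rank → ZMod 2} (hv : InD t ρ2 u v) : ι v ∈ H := by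
  have key : ∀ S : Finset (Fin m), InD t ρ2 u (∑ k ∈ S, Pi.single k (v k)) ∧
      ι (∑ k ∈ S, Pi.single k (v k)) ∈ H := by
    intro S
    induction S using Finset.induction_on with
    | empty =>
      rw [Finset.sum_empty, h.map_zero]
      exact ⟨fun k => Submodule.zero_mem _, H.one_mem⟩
    | insert k S hk ih =>
      have hk' := inD_single (hv k)
      rw [Finset.sum_insert hk, h.map_add _ _ hk' ih.1]
      exact ⟨inD_add hk' ih.1, H.mul_mem (hH k _ (hv k)) ih.2⟩
  have := (key Finset.univ).2
  rwa [Finset.univ_sum_single] at this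

theorem SdpHyp.single_mem (h : SdpHyp t ρ2 u π ι) {H : Subgroup G} (hπ : ∀ g, π g ∈ H)
    (hι : ∀ k, ι (uTup t u k) ∈ H) (k : Fin m) {w : Fin t.rank → ZMod 2}
    (hw : w ∈ Lambda t ρ2 u k) : ι (Pi.single k w) ∈ H := by
  have hzero : ι (Pi.single k 0) ∈ H := by
    rw [Pi.single_zero, h.map_zero]
    exact H.one_mem
  induction hw using Submodule.span_induction with
  | mem x hx =>
    obtain ⟨g, rfl⟩ := hx
    have hconj := h.conj g _ (inD_uTup k)
    rw [uTup, apply_single] at hconj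
    rw [← hconj]
    exact H.mul_mem (H.mul_mem (hπ g) (hι k)) (H.inv_mem (hπ g))
  | zero => exact hzero
  | add x y hx hy hx' hy' =>
    rw [Pi.single_add, h.map_add _ _ (inD_single hx) (inD_single hy)]
    exact H.mul_mem hx' hy'
  | smul c x _ hx =>
    obtain rfl | rfl : c = 0 ∨ c = 1 := by decide +revert
    · rwa [zero_smul]
    · rwa [one_smul]

theorem SdpHyp.exists_hom (h : SdpHyp t ρ2 u π ι) {a : Fin m → Fin t.rank}
    {WΓ : Type*} [Group WΓ] (csΓ : CoxeterSystem (daggerCM t a) WΓ)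
    (csΨ : CoxeterSystem (weylCM t) WΨ)
    (hρ2 : ∀ i, ρ2 (csΨ.simple i) = (reflM2 t i).mulVecLin)
    (hu : ∀ k, IsPaperVector t (a k) (u k)) :
    ∃ φ : WΓ →* G, PhiCond t csΓ csΨ π ι u φ := by
  have hs : ∀ i, csΨ.simple i * csΨ.simple i = 1 := csΨ.simple_mul_simple_self
  have hfix : ∀ i k, a k ≠ i → Commute (π (csΨ.simple i)) (ι (uTup t u k)) := by
    intro i k hik
    refine h.commute_of_fixed (inD_uTup k) ?_
    rw [uTup, apply_single, hρ2, Matrix.mulVecLin_apply,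
      reflM2_mulVec_ubar ((hu k).2.2.1 i (Ne.symm hik))]
  have hsq : ∀ i k, a k ≠ i → (π (csΨ.simple i) * ι (uTup t u k)) ^ 2 = 1 := by
    intro i k hik
    rw [(hfix i k hik).mul_pow, pow_two, pow_two, ← map_mul, hs, map_one,
      h.mul_self (inD_uTup k), one_mul]
  have hswap : ∀ (x y : G) (n : ℕ), (x * y) ^ n = 1 → (y * x) ^ n = 1 := by
    intro x y n hxy
    rw [show y * x = x⁻¹ * (x * y) * x⁻¹⁻¹ by group, conj_pow, hxy]
    group
  have hlift : (daggerCM t a).IsLiftable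
      (Sum.elim (fun i => π (csΨ.simple i)) fun k => ι (uTup t u k)) := by
    have hmixed : ∀ i k, (π (csΨ.simple i) * ι (uTup t u k)) ^
        (if a k = i then 4 else 2) = 1 := by
      intro i k
      split_ifs with hik
      · exact h.pow_four (hs i) (inD_uTup k)
      · exact hsq i k hik
    rintro (i | k) (j | l)
    · change (π (csΨ.simple i) * π (csΨ.simple j)) ^ (weylCM t i j) = 1
      rw [← map_mul, ← map_pow, csΨ.simple_mul_simple_pow, map_one]
    · exact hmixed i l
    · exact hswap _ _ _ (hmixed j k)
    · change (ι (uTup t u k) * ι (uTup t u l)) ^ (if k = l then 1 else 2) = 1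
      split_ifs with hkl
      · rw [hkl, pow_one, h.mul_self (inD_uTup l)]
      · rw [Commute.mul_pow (h.map_mul_comm (inD_uTup k) (inD_uTup l)), pow_two, pow_two,
          h.mul_self (inD_uTup k), h.mul_self (inD_uTup l), one_mul]
  exact ⟨csΓ.lift ⟨_, hlift⟩, fun j => csΓ.lift_apply_simple hlift (Sum.inl j),
    fun k => csΓ.lift_apply_simple hlift (Sum.inr k)⟩

theorem SdpHyp.surjective (h : SdpHyp t ρ2 u π ι) {a : Fin m → Fin t.rank}
    {WΓ : Type*} [Group WΓ] {csΓ : CoxeterSystem (daggerCM t a) WΓ}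
    {csΨ : CoxeterSystem (weylCM t) WΨ} {φ : WΓ →* G} (hφ : PhiCond t csΓ csΨ π ι u φ) :
    Function.Surjective φ := by
  have hπ : ∀ g, π g ∈ φ.range := by
    intro g
    induction g using csΨ.simple_induction with
    | simple i => exact ⟨_, hφ.1 i⟩
    | one => rw [map_one]; exact one_mem _
    | mul x y hx hy => rw [map_mul]; exact mul_mem hx hy
  intro x
  obtain ⟨v, g, hv, rfl⟩ := h.decomp x
  exact mul_mem (h.mem_of_single_mem (fun k _ => h.single_mem hπ (fun k => ⟨_, hφ.2 k⟩) k) hv)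
    (hπ g)

theorem SdpHyp.card_eq (h : SdpHyp t ρ2 u π ι) (htop : ∀ k, Lambda t ρ2 u k = ⊤) :
    Nat.card G = 2 ^ (m * t.rank) * Nat.card WΨ := by
  have hD : ∀ v, InD t ρ2 u v := fun v k => by rw [htop k]; trivial
  have hbij : Function.Bijective
      fun p : (Fin m → Fin t.rank → ZMod 2) × WΨ => ι p.1 * π p.2 := by
    constructor
    · rintro ⟨v, g⟩ ⟨w, k⟩ hvw
      obtain ⟨rfl, rfl⟩ := h.uniq v w g k (hD v) (hD w) hvw
      rfl
    · intro x
      obtain ⟨v, g, -, rfl⟩ := h.decomp x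
      exact ⟨(v, g), rfl⟩
  rw [← Nat.card_eq_of_bijective _ hbij, Nat.card_prod]
  simp [← pow_mul, mul_comm]

end Dagger

/-- The assignment `s ↦ (𝟎, s)`, `t_k ↦ (𝐮_k, 1)` extends to a surjective
homomorphism `φ : W(Γ) → ∏ Λ_k/2 ⋊ W(Ψ)`; moreover if every `(Ψ, s_k)` is admissible, the
target is a finite group of order `2^{mn}·|W(Ψ)|`. -/
theorem statement9 (t : WeylType) (hval : t.Valid) {m : ℕ}
    (a : Fin m → Fin t.rank) (ha : Function.Injective a)
    {WΓ : Type*} [Group WΓ] (csΓ : CoxeterSystem (daggerCM t a) WΓ)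
    {WΨ : Type*} [Group WΨ] (csΨ : CoxeterSystem (weylCM t) WΨ)
    (ρ2 : WΨ →* Module.End (ZMod 2) (Fin t.rank → ZMod 2))
    (hρ2 : ∀ i, ρ2 (csΨ.simple i) = (reflM2 t i).mulVecLin)
    (u : Fin m → Fin t.rank → ℤ) (hu : ∀ k, IsPaperVector t (a k) (u k))
    {G : Type*} [Group G] (π : WΨ →* G) (ι : (Fin m → Fin t.rank → ZMod 2) → G)
    (hsdp : SdpHyp t ρ2 u π ι) :
    (∃ φ : WΓ →* G, PhiCond t csΓ csΨ π ι u φ ∧ Function.Surjective φ) ∧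
      ((∀ k, Admissible t (a k)) → Nat.card G = 2 ^ (m * t.rank) * Nat.card WΨ) := by
  obtain ⟨φ, hφ⟩ := hsdp.exists_hom csΓ csΨ hρ2 hu
  exact ⟨⟨φ, hφ, hsdp.surjective hφ⟩, fun hadm =>
    hsdp.card_eq fun k => Lambda_eq_top hval hρ2 (hu k) (hadm k)⟩

end RootPaper
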